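/- arXiv:1910.08807 — 3 statements merged into one kernel-verified Lean document; each statement's English description precedes it below -/
import Mathlib

section
/- Let B : ℝ² → ℝ⁵ be the map B(s,t) = ( sinh(2s/√3) − t²/3 − (7/8 + t⁴/18)·e^{2s/√3}, t + (t³/3 − t/4)·e^{2s/√3}, 1/2 + (t²/2)·e^{2s/√3}, t + (t³/3 + t/4)·e^{2s/√3}, sinh(2s/√3) − t²/3 − (1/8 + t⁴/18)·e^{2s/√3} ). Then for all (s,t) ∈ ℝ², ⟨B(s,t), B(s,t)⟩₃ = −1; that is, the image of B lies in the pseudo-hyperbolic space H⁴₂(−1) ⊂ 𝔼⁵₃. -/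
/-- The pseudo-Euclidean inner product of index 3 on `ℝ⁵` (the space `𝔼⁵₃`):
`⟨x,y⟩₃ = -x₀y₀ - x₁y₁ - x₂y₂ + x₃y₃ + x₄y₄`. -/
noncomputable def innerE53 (x y : Fin 5 → ℝ) : ℝ :=
  -(x 0 * y 0) - x 1 * y 1 - x 2 * y 2 + x 3 * y 3 + x 4 * y 4

/-- The map `B : ℝ² → ℝ⁵` of Chen. -/
noncomputable def Bmap (s t : ℝ) : Fin 5 → ℝ :=
  ![Real.sinh (2 * s / Real.sqrt 3) - t ^ 2 / 3
      - (7 / 8 + t ^ 4 / 18) * Real.exp (2 * s / Real.sqrt 3),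
    t + (t ^ 3 / 3 - t / 4) * Real.exp (2 * s / Real.sqrt 3),
    1 / 2 + (t ^ 2 / 2) * Real.exp (2 * s / Real.sqrt 3),
    t + (t ^ 3 / 3 + t / 4) * Real.exp (2 * s / Real.sqrt 3),
    Real.sinh (2 * s / Real.sqrt 3) - t ^ 2 / 3
      - (1 / 8 + t ^ 4 / 18) * Real.exp (2 * s / Real.sqrt 3)]

/-- For all `(s,t) ∈ ℝ²`, `⟨B(s,t), B(s,t)⟩₃ = -1`; i.e. the image of `B` lies in the
pseudo-hyperbolic space `H⁴₂(-1) ⊂ 𝔼⁵₃`. -/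
theorem Bmap_mem_pseudoHyperbolic :
    ∀ s t : ℝ, innerE53 (Bmap s t) (Bmap s t) = -1 := by
  intro s t
  have h : Real.exp (2 * s / Real.sqrt 3) * Real.exp (-(2 * s / Real.sqrt 3)) = 1 := by
    rw [← Real.exp_add]; simp
  simp only [innerE53, Bmap, Real.sinh_eq]
  simp
  generalize Real.exp (2 * s / Real.sqrt 3) = E at *
  generalize Real.exp (-(2 * s / Real.sqrt 3)) = F at *
  linear_combination (-3 / 4) * h
end

section
/- Let B : ℝ² → ℝ⁵ be the map B(s,t) = ( sinh(2s/√3) − t²/3 − (7/8 + t⁴/18)·e^{2s/√3}, t + (t³/3 − t/4)·e^{2s/√3}, 1/2 + (t²/2)·e^{2s/√3}, t + (t³/3 + t/4)·e^{2s/√3}, sinh(2s/√3) − t²/3 − (1/8 + t⁴/18)·e^{2s/√3} ). Then for all (s,t) ∈ ℝ², the partial derivatives satisfy ⟨∂B/∂s, ∂B/∂s⟩₃ = 1, ⟨∂B/∂s, ∂B/∂t⟩₃ = 0 and ⟨∂B/∂t, ∂B/∂t⟩₃ = e^{2s/√3}; that is, the induced metric of B is ds² + e^{2s/√3} dt²,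 so B is an isometric immersion of the hyperbolic plane of constant curvature −1/3. -/
/-- The induced metric of `B` is `ds² + e^{2s/√3} dt²`:
`⟨B_s, B_s⟩₃ = 1`, `⟨B_s, B_t⟩₃ = 0` and `⟨B_t, B_t⟩₃ = e^{2s/√3}`. -/
theorem Bmap_inducedMetric :
    ∀ s t : ℝ,
      innerE53 (deriv (fun s' => Bmap s' t) s) (deriv (fun s' => Bmap s' t) s) = 1 ∧
      innerE53 (deriv (fun s' => Bmap s' t) s) (deriv (fun t' => Bmap s t') t) = 0 ∧
      innerE53 (deriv (fun t' => Bmap s t') t) (deriv (fun t' => Bmap s t') t)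
        = Real.exp (2 * s / Real.sqrt 3) := by
  intro s t
  have h3 : Real.sqrt 3 ^ 2 = 3 := Real.sq_sqrt (by norm_num)
  obtain ⟨c, hc⟩ : ∃ c : ℝ, c = 2 / Real.sqrt 3 := ⟨_, rfl⟩
  have hc2 : c ^ 2 = 4 / 3 := by rw [hc, div_pow, h3]; norm_num
  have hl : HasDerivAt (fun x : ℝ => 2 * x / Real.sqrt 3) c s := by
    have := ((hasDerivAt_id s).const_mul 2).div_const (Real.sqrt 3)
    simpa [hc] using this
  have hE := hl.exp
  have hS := hl.sinh
  have hw : Real.exp (2 * s / Real.sqrt 3) * Real.exp (-(2 * s / Real.sqrt 3)) = 1 := by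
    rw [← Real.exp_add]; simp
  have hch := Real.cosh_eq (2 * s / Real.sqrt 3)
  have hs : HasDerivAt (fun s' => Bmap s' t)
      ![Real.cosh (2 * s / Real.sqrt 3) * c
          - (7 / 8 + t ^ 4 / 18) * (Real.exp (2 * s / Real.sqrt 3) * c),
        (t ^ 3 / 3 - t / 4) * (Real.exp (2 * s / Real.sqrt 3) * c),
        (t ^ 2 / 2) * (Real.exp (2 * s / Real.sqrt 3) * c),
        (t ^ 3 / 3 + t / 4) * (Real.exp (2 * s / Real.sqrt 3) * c),
        Real.cosh (2 * s / Real.sqrt 3) * c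
          - (1 / 8 + t ^ 4 / 18) * (Real.exp (2 * s / Real.sqrt 3) * c)] s := by
    rw [hasDerivAt_pi]
    intro i
    fin_cases i
    · exact (hS.sub_const _).sub (hE.const_mul _)
    · exact (hE.const_mul _).const_add _
    · exact (hE.const_mul _).const_add _
    · exact (hE.const_mul _).const_add _
    · exact (hS.sub_const _).sub (hE.const_mul _)
  have hp : ∀ n : ℕ, HasDerivAt (fun x : ℝ => x ^ n) (n * t ^ (n - 1)) t :=
    fun n => hasDerivAt_pow n t
  have ht : HasDerivAt (fun t' => Bmap s t')
      ![-(2 * t / 3) - (2 * t ^ 3 / 9) * Real.exp (2 * s / Real.sqrt 3),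
        1 + (t ^ 2 - 1 / 4) * Real.exp (2 * s / Real.sqrt 3),
        t * Real.exp (2 * s / Real.sqrt 3),
        1 + (t ^ 2 + 1 / 4) * Real.exp (2 * s / Real.sqrt 3),
        -(2 * t / 3) - (2 * t ^ 3 / 9) * Real.exp (2 * s / Real.sqrt 3)] t := by
    rw [hasDerivAt_pi]
    intro i
    fin_cases i
    · refine ((((hp 2).div_const 3).const_sub _).sub
        ((((hp 4).div_const 18).const_add _).mul_const _)).congr_deriv ?_
      simp; ring
    · refine ((hasDerivAt_id t).add
        ((((hp 3).div_const 3).sub ((hasDerivAt_id t).div_const 4)).mul_const _)).congr_deriv ?_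
      simp
    · refine ((((hp 2).div_const 2).mul_const _).const_add _).congr_deriv ?_
      simp
    · refine ((hasDerivAt_id t).add
        ((((hp 3).div_const 3).add ((hasDerivAt_id t).div_const 4)).mul_const _)).congr_deriv ?_
      simp
    · refine ((((hp 2).div_const 3).const_sub _).sub
        ((((hp 4).div_const 18).const_add _).mul_const _)).congr_deriv ?_
      simp; ring
  rw [hs.deriv, ht.deriv]
  simp only [innerE53, Matrix.cons_val, hch]
  generalize Real.exp (2 * s / Real.sqrt 3) = E at *
  generalize Real.exp (-(2 * s / Real.sqrt 3)) = F at *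
  refine ⟨?_, ?_, ?_⟩
  · linear_combination (3 / 4 * E * F) * hc2 + hw
  · ring
  · ring
end

section
/- Let r > 0 and b ≥ −1/r², and let L : ℝ² → ℝ⁵ be defined by L(u,v) = r·( u² + v² + b + 1/4, √(1 + b r²)/r, u, v, u² + v² + b − 1/4 ). Then for all (u,v) ∈ ℝ²: (i) ⟨L(u,v), L(u,v)⟩₁ = 1, so the image of L lies in the pseudo-sphere S⁴₁(1) ⊂ 𝔼⁵₁; and (ii) ⟨∂L/∂u, ∂L/∂u⟩₁ = r², ⟨∂L/∂u, ∂L/∂v⟩₁ = 0, ⟨∂L/∂v, ∂L/∂v⟩₁ = r², so L induces the flat metric r²(du² + dv²). -/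
/-- The pseudo-Euclidean inner product of index 1 on `ℝ⁵` (the space `𝔼⁵₁`):
`⟨x,y⟩₁ = -x₀y₀ + x₁y₁ + x₂y₂ + x₃y₃ + x₄y₄`. -/
noncomputable def innerE51 (x y : Fin 5 → ℝ) : ℝ :=
  -(x 0 * y 0) + x 1 * y 1 + x 2 * y 2 + x 3 * y 3 + x 4 * y 4

/-- The map `L(u,v) = r·(u² + v² + b + 1/4, √(1 + b r²)/r, u, v, u² + v² + b - 1/4)`. -/
noncomputable def Lmap (r b u v : ℝ) : Fin 5 → ℝ :=
  ![r * (u ^ 2 + v ^ 2 + b + 1 / 4), r * (Real.sqrt (1 + b * r ^ 2) / r),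
    r * u, r * v, r * (u ^ 2 + v ^ 2 + b - 1 / 4)]

theorem Lmap_deriv_u (r b u v : ℝ) :
    deriv (fun u' => Lmap r b u' v) u = ![r * (2 * u), 0, r, 0, r * (2 * u)] := by
  apply HasDerivAt.deriv
  rw [hasDerivAt_pi]
  have h : HasDerivAt (fun x : ℝ => x ^ 2) (2 * u) u := by
    simpa using hasDerivAt_pow 2 u
  intro i
  fin_cases i
  · exact (((h.add_const (v ^ 2)).add_const b).add_const (1 / 4)).const_mul r
  · exact hasDerivAt_const u _
  · simpa [Lmap] using (hasDerivAt_id u).const_mul r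
  · exact hasDerivAt_const u _
  · exact (((h.add_const (v ^ 2)).add_const b).sub_const (1 / 4)).const_mul r

theorem Lmap_deriv_v (r b u v : ℝ) :
    deriv (fun v' => Lmap r b u v') v = ![r * (2 * v), 0, 0, r, r * (2 * v)] := by
  apply HasDerivAt.deriv
  rw [hasDerivAt_pi]
  have h : HasDerivAt (fun x : ℝ => x ^ 2) (2 * v) v := by
    simpa using hasDerivAt_pow 2 v
  intro i
  fin_cases i
  · exact (((h.const_add (u ^ 2)).add_const b).add_const (1 / 4)).const_mul r
  · exact hasDerivAt_const v _
  · exact hasDerivAt_const v _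
  · simpa [Lmap] using (hasDerivAt_id v).const_mul r
  · exact (((h.const_add (u ^ 2)).add_const b).sub_const (1 / 4)).const_mul r

/-- For `r > 0` and `b ≥ -1/r²`, `L` lies in the pseudo-sphere `S⁴₁(1) ⊂ 𝔼⁵₁` and
induces the flat metric `r²(du² + dv²)`. -/
theorem Lmap_pseudoSphere_flatMetric :
    ∀ r b : ℝ, 0 < r → b ≥ -(1 / r ^ 2) → ∀ u v : ℝ,
      innerE51 (Lmap r b u v) (Lmap r b u v) = 1 ∧
      innerE51 (deriv (fun u' => Lmap r b u' v) u) (deriv (fun u' => Lmap r b u' v) u)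
        = r ^ 2 ∧
      innerE51 (deriv (fun u' => Lmap r b u' v) u) (deriv (fun v' => Lmap r b u v') v)
        = 0 ∧
      innerE51 (deriv (fun v' => Lmap r b u v') v) (deriv (fun v' => Lmap r b u v') v)
        = r ^ 2 := by
  intro r b hr hb u v
  have hnn : 0 ≤ 1 + b * r ^ 2 := by
    have h1 : -(1 / r ^ 2) * r ^ 2 ≤ b * r ^ 2 :=
      mul_le_mul_of_nonneg_right hb (sq_nonneg r)
    have h2 : -(1 / r ^ 2) * r ^ 2 = -1 := by field_simp
    linarith
  rw [Lmap_deriv_u, Lmap_deriv_v]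
  refine ⟨?_, ?_, ?_, ?_⟩
  · have hs := Real.mul_self_sqrt hnn
    have hc : r * (Real.sqrt (1 + b * r ^ 2) / r) = Real.sqrt (1 + b * r ^ 2) := by
      field_simp
    simp only [innerE51, Lmap, hc, Matrix.cons_val]
    linear_combination hs
  all_goals
    simp only [innerE51, Matrix.cons_val]
    ring
end
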